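/- Let β ∈ (0,1) and p ∈ (1,∞). Consider the weights w, σ on ℝ given by w(x) = |x|^{−β} and σ(x) = |x|^{β/(p−1)} for x ≠ 0 (and w(0) = σ(0) = 1). Then [w,σ]_{A_p} is comparable to (1−β)^{−1}, with comparability constants depending only on p. In particular, [w]_{A_∞} ≤ C(1−β)^{−1} for an absolute constant C, and [σ]_{A_∞} ≤ C(p) for a constant depending only on p. -/

import Mathlib

open MeasureTheory Set Filter
open scoped ENNReal NNReal

noncomputable section

/-- Average of `g` over the interval `[a, b)` (with respect to Lebesgue measure). -/
def avgI (g : ℝ → ℝ) (a b : ℝ) : ℝ := (b - a)⁻¹ * ∫ x in Set.Ico a b, g x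

/-- The dyadic interval `[k·2^{-n}, (k+1)·2^{-n})`. -/
def dyadicI (n k : ℤ) : Set ℝ :=
  Set.Ico ((k : ℝ) * (2:ℝ) ^ (-n)) (((k : ℝ) + 1) * (2:ℝ) ^ (-n))

/-- Average of `g` over the dyadic interval `dyadicI n k`. -/
def avgD (g : ℝ → ℝ) (n k : ℤ) : ℝ :=
  avgI g ((k : ℝ) * (2:ℝ) ^ (-n)) (((k : ℝ) + 1) * (2:ℝ) ^ (-n))

/-- The martingale difference `Δ_Q g` associated with the dyadic interval `Q = dyadicI n k`:
`Δ_Q g = Σ_{R child of Q} ⟨g⟩_R 1_R − ⟨g⟩_Q 1_Q`. -/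
def deltaD (g : ℝ → ℝ) (n k : ℤ) (x : ℝ) : ℝ :=
  (dyadicI (n+1) (2*k)).indicator (fun _ => avgD g (n+1) (2*k)) x
    + (dyadicI (n+1) (2*k+1)).indicator (fun _ => avgD g (n+1) (2*k+1)) x
    - (dyadicI n k).indicator (fun _ => avgD g n k) x

/-- The dyadic square function on `ℝ`. -/
def sqFn (g : ℝ → ℝ) (x : ℝ) : ℝ :=
  Real.sqrt (∑' q : ℤ × ℤ, (deltaD g q.1 q.2 x) ^ 2)

open Classical in
/-- The dyadic square function over `[0,1)`: the sum runs only over dyadic intervals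
contained in `[0,1)`. -/
def sqFn01 (g : ℝ → ℝ) (x : ℝ) : ℝ :=
  Real.sqrt (∑' q : ℤ × ℤ,
    if dyadicI q.1 q.2 ⊆ Set.Ico (0:ℝ) 1 then (deltaD g q.1 q.2 x) ^ 2 else 0)

/-- `‖g‖_{L^p(w)}` (as an extended nonnegative real), `w dx` being the underlying measure. -/
def pNorm (p : ℝ) (g w : ℝ → ℝ) : ℝ≥0∞ :=
  (∫⁻ x : ℝ, ENNReal.ofReal (|g x| ^ p * w x)) ^ (1/p)

/-- `‖g‖_{L^p(w)}` over `[0,1)`. -/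
def pNorm01 (p : ℝ) (g w : ℝ → ℝ) : ℝ≥0∞ :=
  (∫⁻ x in Set.Ico (0:ℝ) 1, ENNReal.ofReal (|g x| ^ p * w x)) ^ (1/p)

/-- The joint `A_p` characteristic `[w,σ]_{A_p}`, the supremum running over all bounded
intervals of `ℝ`. -/
def apChar (p : ℝ) (w σ : ℝ → ℝ) : ℝ≥0∞ :=
  ⨆ (a : ℝ) (b : ℝ) (_ : a < b),
    ENNReal.ofReal (avgI w a b * (avgI σ a b) ^ (p - 1))

/-- The joint `A_p` characteristic `[w,σ]_{A_p}`, the supremum running over all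
subintervals of `[0,1)`. -/
def apChar01 (p : ℝ) (w σ : ℝ → ℝ) : ℝ≥0∞ :=
  ⨆ (a : ℝ) (b : ℝ) (_ : 0 ≤ a) (_ : a < b) (_ : b ≤ 1),
    ENNReal.ofReal (avgI w a b * (avgI σ a b) ^ (p - 1))

/-- The local maximal function `M_{[a,b)} σ (x) = sup { ⟨σ⟩_R : R interval ⊆ [a,b), x ∈ R }`. -/
def maxFn (σ : ℝ → ℝ) (a b x : ℝ) : ℝ≥0∞ :=
  ⨆ (c : ℝ) (e : ℝ) (_ : a ≤ c) (_ : c < e) (_ : e ≤ b) (_ : x ∈ Set.Ico c e),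
    ENNReal.ofReal (avgI σ c e)

/-- The Fujii–Wilson `A_∞` characteristic
`[σ]_{A_∞} = sup_Q (1/σ(Q)) ∫_Q M_Q σ`, the supremum over bounded intervals of `ℝ`. -/
def ainfChar (σ : ℝ → ℝ) : ℝ≥0∞ :=
  ⨆ (a : ℝ) (b : ℝ) (_ : a < b),
    (∫⁻ x in Set.Ico a b, maxFn σ a b x) / ENNReal.ofReal (∫ x in Set.Ico a b, σ x)

/-- A weight on `ℝ`: measurable, a.e. positive, integrable over every bounded interval. -/
def IsWeight (w : ℝ → ℝ) : Prop :=
  Measurable w ∧ (∀ᵐ x : ℝ, 0 < w x) ∧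
    ∀ a b : ℝ, a < b → IntegrableOn w (Set.Ico a b)

/-- A weight on `[0,1)`: measurable, a.e. positive on `[0,1)`, integrable over `[0,1)`. -/
def IsWeight01 (w : ℝ → ℝ) : Prop :=
  Measurable w ∧ (∀ᵐ x : ℝ, x ∈ Set.Ico (0:ℝ) 1 → 0 < w x) ∧
    IntegrableOn w (Set.Ico (0:ℝ) 1)


/-- The power weight `|x| ^ s`, with value `1` at the origin. -/
def powerWeight (s x : ℝ) : ℝ := if x = 0 then 1 else |x| ^ s

lemma powerWeight_of_ne {s x : ℝ} (hx : x ≠ 0) : powerWeight s x = |x| ^ s := if_neg hx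

lemma powerWeight_nonneg (s x : ℝ) : 0 ≤ powerWeight s x := by
  unfold powerWeight
  split_ifs <;> positivity

lemma ae_ne_zero : ∀ᵐ x : ℝ, x ≠ 0 := by
  simp [ae_iff]

lemma powerWeight_ae_eq (s : ℝ) : powerWeight s =ᵐ[volume] fun x => |x| ^ s := by
  filter_upwards [ae_ne_zero] with x hx using powerWeight_of_ne hx

lemma intervalIntegrable_abs_rpow_right {s : ℝ} (hs : -1 < s) {m : ℝ} (hm : 0 ≤ m) :
    IntervalIntegrable (fun x : ℝ => |x| ^ s) volume 0 m := by
  refine (intervalIntegral.intervalIntegrable_rpow' hs).congr fun x hx => ?_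
  rw [uIoc_of_le hm] at hx
  simp only [abs_of_pos hx.1]

lemma intervalIntegrable_abs_rpow_left {s : ℝ} (hs : -1 < s) {m : ℝ} (hm : 0 ≤ m) :
    IntervalIntegrable (fun x : ℝ => |x| ^ s) volume (-m) 0 := by
  simpa using ((IntervalIntegrable.iff_comp_neg (f := fun x : ℝ => |x| ^ s)).mp
    (intervalIntegrable_abs_rpow_right hs hm)).symm

lemma integral_abs_rpow_right {s : ℝ} (hs : -1 < s) {m : ℝ} (hm : 0 ≤ m) :
    ∫ x in (0:ℝ)..m, |x| ^ s = m ^ (s + 1) / (s + 1) := by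
  have h : ∫ x in (0:ℝ)..m, |x| ^ s = ∫ x in (0:ℝ)..m, x ^ s :=
    intervalIntegral.integral_congr fun x hx => by
      rw [uIcc_of_le hm] at hx
      simp only [abs_of_nonneg hx.1]
  rw [h, integral_rpow (Or.inl hs), Real.zero_rpow (by linarith), sub_zero]

lemma integral_abs_rpow_symm {s : ℝ} (hs : -1 < s) {m : ℝ} (hm : 0 ≤ m) :
    ∫ x in (-m)..m, |x| ^ s = 2 * (m ^ (s + 1) / (s + 1)) := by
  have h : ∫ x in (-m)..0, |x| ^ s = ∫ x in (0:ℝ)..m, |x| ^ s := by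
    simpa using (intervalIntegral.integral_comp_neg (a := 0) (b := m)
      (fun x : ℝ => |x| ^ s)).symm
  rw [← intervalIntegral.integral_add_adjacent_intervals (intervalIntegrable_abs_rpow_left hs hm)
    (intervalIntegrable_abs_rpow_right hs hm), h, integral_abs_rpow_right hs hm]
  ring

lemma integrableOn_powerWeight_symm {s : ℝ} (hs : -1 < s) {m : ℝ} (hm : 0 ≤ m) :
    IntegrableOn (powerWeight s) (Ico (-m) m) := by
  have h := (intervalIntegrable_abs_rpow_left hs hm).trans (intervalIntegrable_abs_rpow_right hs hm)
  rw [intervalIntegrable_iff_integrableOn_Ico_of_le (by linarith)] at h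
  exact h.congr (ae_restrict_of_ae (powerWeight_ae_eq s).symm)

lemma setIntegral_powerWeight_symm {s : ℝ} (hs : -1 < s) {m : ℝ} (hm : 0 ≤ m) :
    ∫ x in Ico (-m) m, powerWeight s x = 2 * (m ^ (s + 1) / (s + 1)) := by
  rw [integral_congr_ae (ae_restrict_of_ae (powerWeight_ae_eq s)), integral_Ico_eq_integral_Ioc,
    ← intervalIntegral.integral_of_le (by linarith), integral_abs_rpow_symm hs hm]

lemma Ico_subset_symm (a b : ℝ) : Ico a b ⊆ Ico (-max |a| |b|) (max |a| |b|) :=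
  Ico_subset_Ico (by linarith [neg_abs_le a, le_max_left |a| |b|])
    ((le_abs_self b).trans (le_max_right _ _))

lemma abs_le_max_of_mem_Ico {a b x : ℝ} (hx : x ∈ Ico a b) : |x| ≤ max |a| |b| :=
  abs_le_max_abs_abs hx.1 hx.2.le

lemma max_abs_pos_of_lt {a b : ℝ} (hab : a < b) : 0 < max |a| |b| := by
  by_contra! h
  have ha := abs_nonpos_iff.mp ((le_max_left |a| |b|).trans h)
  have hb := abs_nonpos_iff.mp ((le_max_right |a| |b|).trans h)
  linarith

lemma sub_le_two_mul_max_abs (a b : ℝ) : b - a ≤ 2 * max |a| |b| := by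
  linarith [neg_abs_le a, le_max_left |a| |b|, le_abs_self b, le_max_right |a| |b|]

lemma integrableOn_powerWeight {s : ℝ} (hs : -1 < s) (a b : ℝ) :
    IntegrableOn (powerWeight s) (Ico a b) :=
  (integrableOn_powerWeight_symm hs ((abs_nonneg a).trans (le_max_left _ _))).mono_set
    (Ico_subset_symm a b)

lemma avgI_powerWeight_nonneg (s : ℝ) {a b : ℝ} (hab : a < b) :
    0 ≤ avgI (powerWeight s) a b :=
  mul_nonneg (inv_nonneg.mpr (sub_nonneg.mpr hab.le))
    (integral_nonneg (powerWeight_nonneg s))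

/-- An average is at most an a.e. upper bound for the function. -/
lemma avgI_powerWeight_le_of_forall {s : ℝ} (hs : -1 < s) {a b K : ℝ} (hab : a < b)
    (hK : ∀ x ∈ Ico a b, x ≠ 0 → |x| ^ s ≤ K) : avgI (powerWeight s) a b ≤ K := by
  have hl : 0 < b - a := sub_pos.mpr hab
  have h : ∫ x in Ico a b, powerWeight s x ≤ ∫ _ in Ico a b, K := by
    refine integral_mono_ae (integrableOn_powerWeight hs a b) (by simp) ?_
    filter_upwards [ae_restrict_mem measurableSet_Ico, ae_restrict_of_ae ae_ne_zero] with x hx hx0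
    rw [powerWeight_of_ne hx0]
    exact hK x hx hx0
  have hc : ∫ _ in Ico a b, K = (b - a) * K := by simp [hab.le]
  rw [avgI, inv_mul_le_iff₀ hl]
  exact h.trans_eq hc

lemma avgI_powerWeight_neg_le {β : ℝ} (h0 : 0 < β) (h1 : β < 1) {a b : ℝ} (hab : a < b) :
    avgI (powerWeight (-β)) a b ≤ 4 * (1 - β)⁻¹ * max |a| |b| ^ (-β) := by
  set m := max |a| |b| with hm
  have hmpos : 0 < m := max_abs_pos_of_lt hab
  have hl : 0 < b - a := sub_pos.mpr hab
  have hβ : 0 < 1 - β := by linarith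
  have hP : 0 < m ^ (-β) := by positivity
  have hinv : 1 ≤ (1 - β)⁻¹ := (one_le_inv₀ hβ).mpr (by linarith)
  rcases le_or_gt (m / 2) (b - a) with hbig | hsmall
  · have h2 : ∫ x in Ico a b, powerWeight (-β) x ≤ 2 * (m ^ (-β + 1) / (-β + 1)) := by
      rw [← setIntegral_powerWeight_symm (by linarith) hmpos.le]
      exact setIntegral_mono_set (integrableOn_powerWeight_symm (by linarith) hmpos.le)
        (ae_of_all _ (powerWeight_nonneg _)) (Ico_subset_symm a b).eventuallyLE
    rw [avgI, inv_mul_le_iff₀ hl]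
    refine h2.trans ?_
    rw [Real.rpow_add_one hmpos.ne', show -β + 1 = 1 - β by ring, div_eq_mul_inv]
    have h3 : 0 < m ^ (-β) * (1 - β)⁻¹ := by positivity
    nlinarith [mul_le_mul_of_nonneg_right hbig h3.le]
  · have h2 : avgI (powerWeight (-β)) a b ≤ (m / 2) ^ (-β) := by
      refine avgI_powerWeight_le_of_forall (by linarith) hab fun x hx _ => ?_
      refine Real.rpow_le_rpow_of_nonpos (by positivity) ?_ (by linarith)
      rcases max_choice |a| |b| with h | h
      · have := abs_sub_abs_le_abs_sub a x
        rw [abs_sub_comm, abs_of_nonneg (sub_nonneg.mpr hx.1)] at this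
        linarith [hx.2]
      · have := abs_sub_abs_le_abs_sub b x
        rw [abs_of_nonneg (sub_nonneg.mpr hx.2.le)] at this
        linarith [hx.1]
    refine h2.trans ?_
    rw [Real.div_rpow hmpos.le two_pos.le, Real.rpow_neg two_pos.le, div_inv_eq_mul]
    have h4 : (2:ℝ) ^ β ≤ 2 := by
      simpa using Real.rpow_le_rpow_of_exponent_le (one_le_two (α := ℝ)) h1.le
    nlinarith [mul_le_mul_of_nonneg_left h4 hP.le, mul_le_mul_of_nonneg_left hinv hP.le]

lemma avgI_powerWeight_le_max_rpow {γ : ℝ} (hγ : 0 ≤ γ) {a b : ℝ} (hab : a < b) :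
    avgI (powerWeight γ) a b ≤ max |a| |b| ^ γ :=
  avgI_powerWeight_le_of_forall (by linarith) hab fun _ hx _ =>
    Real.rpow_le_rpow (abs_nonneg _) (abs_le_max_of_mem_Ico hx) hγ

/-- Lower bound for the mass of a positive power weight on a subinterval away from the origin. -/
lemma mul_rpow_le_setIntegral_powerWeight {γ : ℝ} (hγ : 0 ≤ γ) {a b c e K : ℝ} (hK : 0 ≤ K)
    (hac : a ≤ c) (hce : c ≤ e) (heb : e ≤ b) (h : ∀ x ∈ Ico c e, K ≤ |x|) :
    (e - c) * K ^ γ ≤ ∫ x in Ico a b, powerWeight γ x := by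
  have hc : (e - c) * K ^ γ = ∫ _ in Ico c e, K ^ γ := by simp [hce]
  rw [hc]
  refine le_trans (integral_mono_ae (by simp) (integrableOn_powerWeight (by linarith) c e) ?_)
    (setIntegral_mono_set (integrableOn_powerWeight (by linarith) a b)
      (ae_of_all _ (powerWeight_nonneg _)) (Ico_subset_Ico hac heb).eventuallyLE)
  filter_upwards [ae_restrict_mem measurableSet_Ico, ae_restrict_of_ae ae_ne_zero] with x hx hx0
  rw [powerWeight_of_ne hx0]
  exact Real.rpow_le_rpow hK (h x hx) hγ

lemma setIntegral_powerWeight_ge {γ : ℝ} (hγ : 0 ≤ γ) {a b : ℝ} (hab : a < b) :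
    (b - a) / 4 * (max |a| |b| / 2) ^ γ ≤ ∫ x in Ico a b, powerWeight γ x := by
  have hm := max_abs_pos_of_lt hab
  have hl := sub_le_two_mul_max_abs a b
  rcases max_choice |a| |b| with h | h
  · convert mul_rpow_le_setIntegral_powerWeight hγ (a := a) (b := b) (c := a)
      (e := a + (b - a) / 4) (K := max |a| |b| / 2) (by positivity) le_rfl (by linarith)
      (by linarith) ?_ using 2
    · ring
    · intro x hx
      have := abs_sub_abs_le_abs_sub a x
      rw [abs_sub_comm, abs_of_nonneg (sub_nonneg.mpr hx.1)] at this
      linarith [hx.2]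
  · convert mul_rpow_le_setIntegral_powerWeight hγ (a := a) (b := b) (c := b - (b - a) / 4)
      (e := b) (K := max |a| |b| / 2) (by positivity) (by linarith) (by linarith) le_rfl ?_ using 2
    · ring
    · intro x hx
      have := abs_sub_abs_le_abs_sub b x
      rw [abs_of_nonneg (sub_nonneg.mpr hx.2.le)] at this
      linarith [hx.1]

lemma avgI_powerWeight_zero_one {s : ℝ} (hs : -1 < s) :
    avgI (powerWeight s) 0 1 = (s + 1)⁻¹ := by
  rw [avgI, integral_congr_ae (ae_restrict_of_ae (powerWeight_ae_eq s)),
    integral_Ico_eq_integral_Ioc, ← intervalIntegral.integral_of_le zero_le_one,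
    integral_abs_rpow_right hs zero_le_one]
  simp

lemma le_apChar_powerWeight {p β : ℝ} (hp : 1 < p) (h0 : 0 < β) (h1 : β < 1) :
    ENNReal.ofReal ((p / (p - 1))⁻¹ ^ (p - 1) * (1 - β)⁻¹) ≤
      apChar p (powerWeight (-β)) (powerWeight (β / (p - 1))) := by
  have hp' : 0 < p - 1 := by linarith
  have hγ : 0 < β / (p - 1) := by positivity
  refine le_trans (ENNReal.ofReal_le_ofReal ?_)
    (le_iSup_of_le 0 (le_iSup_of_le 1 (le_iSup_of_le one_pos le_rfl)))
  rw [avgI_powerWeight_zero_one (by linarith), avgI_powerWeight_zero_one (by linarith), mul_comm,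
    show -β + 1 = 1 - β by ring]
  refine mul_le_mul_of_nonneg_left (Real.rpow_le_rpow (by positivity) ?_ hp'.le)
    (inv_nonneg.mpr (by linarith))
  refine inv_anti₀ (by positivity) ?_
  rw [div_add_one hp'.ne']
  gcongr
  linarith

lemma apChar_powerWeight_le {p β : ℝ} (hp : 1 < p) (h0 : 0 < β) (h1 : β < 1) :
    apChar p (powerWeight (-β)) (powerWeight (β / (p - 1))) ≤
      ENNReal.ofReal (4 * (1 - β)⁻¹) := by
  have hp' : 0 < p - 1 := by linarith
  have hγ : 0 < β / (p - 1) := by positivity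
  refine iSup_le fun a => iSup_le fun b => iSup_le fun hab => ENNReal.ofReal_le_ofReal ?_
  have hm := max_abs_pos_of_lt hab
  have hσ := Real.rpow_le_rpow (avgI_powerWeight_nonneg _ hab)
    (avgI_powerWeight_le_max_rpow hγ.le hab) hp'.le
  rw [← Real.rpow_mul hm.le, div_mul_cancel₀ _ hp'.ne'] at hσ
  have hβ : 0 < (1 - β)⁻¹ := inv_pos.mpr (by linarith)
  calc _ ≤ 4 * (1 - β)⁻¹ * max |a| |b| ^ (-β) * max |a| |b| ^ β :=
        mul_le_mul (avgI_powerWeight_neg_le h0 h1 hab) hσ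
          (Real.rpow_nonneg (avgI_powerWeight_nonneg _ hab) _) (by positivity)
    _ = 4 * (1 - β)⁻¹ := by
        rw [mul_assoc, ← Real.rpow_add hm, neg_add_cancel, Real.rpow_zero, mul_one]

lemma maxFn_powerWeight_neg_le {β : ℝ} (h0 : 0 < β) (h1 : β < 1) (a b : ℝ) {x : ℝ}
    (hx : x ≠ 0) :
    maxFn (powerWeight (-β)) a b x ≤ ENNReal.ofReal (4 * (1 - β)⁻¹ * powerWeight (-β) x) := by
  refine iSup_le fun c => iSup_le fun e => iSup_le fun _ => iSup_le fun hce => iSup_le fun _ =>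
    iSup_le fun hxce => ENNReal.ofReal_le_ofReal ((avgI_powerWeight_neg_le h0 h1 hce).trans ?_)
  rw [powerWeight_of_ne hx]
  refine mul_le_mul_of_nonneg_left ?_ (mul_nonneg (by norm_num) (inv_nonneg.mpr (by linarith)))
  exact Real.rpow_le_rpow_of_nonpos (abs_pos.mpr hx) (abs_le_max_of_mem_Ico hxce) (by linarith)

lemma ainfChar_powerWeight_neg_le {β : ℝ} (h0 : 0 < β) (h1 : β < 1) :
    ainfChar (powerWeight (-β)) ≤ ENNReal.ofReal (4 * (1 - β)⁻¹) := by
  have hβ : 0 < (1 - β)⁻¹ := inv_pos.mpr (by linarith)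
  refine iSup_le fun a => iSup_le fun b => iSup_le fun _ => ?_
  refine ENNReal.div_le_of_le_mul ?_
  rw [← ENNReal.ofReal_mul (by positivity), ← integral_const_mul,
    ofReal_integral_eq_lintegral_ofReal
      ((integrableOn_powerWeight (by linarith) a b).const_mul _)
      (ae_of_all _ fun x => mul_nonneg (by positivity) (powerWeight_nonneg _ x))]
  refine lintegral_mono_ae ?_
  filter_upwards [ae_restrict_of_ae ae_ne_zero] with x hx
    using maxFn_powerWeight_neg_le h0 h1 a b hx

lemma maxFn_powerWeight_le {γ : ℝ} (hγ : 0 ≤ γ) (a b x : ℝ) :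
    maxFn (powerWeight γ) a b x ≤ ENNReal.ofReal (max |a| |b| ^ γ) := by
  refine iSup_le fun c => iSup_le fun e => iSup_le fun hac => iSup_le fun hce => iSup_le fun heb =>
    iSup_le fun _ => ENNReal.ofReal_le_ofReal ((avgI_powerWeight_le_max_rpow hγ hce).trans ?_)
  exact Real.rpow_le_rpow (by positivity)
    (max_le (abs_le_max_abs_abs hac (hce.le.trans heb)) (abs_le_max_abs_abs (hac.trans hce.le) heb))
    hγ

lemma ainfChar_powerWeight_le {γ : ℝ} (hγ : 0 ≤ γ) :
    ainfChar (powerWeight γ) ≤ ENNReal.ofReal (4 * 2 ^ γ) := by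
  refine iSup_le fun a => iSup_le fun b => iSup_le fun hab => ?_
  have hl : 0 < b - a := sub_pos.mpr hab
  refine ENNReal.div_le_of_le_mul ?_
  rw [← ENNReal.ofReal_mul (by positivity)]
  calc _ ≤ ∫⁻ _ in Ico a b, ENNReal.ofReal (max |a| |b| ^ γ) :=
        lintegral_mono fun x => maxFn_powerWeight_le hγ a b x
    _ = ENNReal.ofReal (max |a| |b| ^ γ * (b - a)) := by
        rw [setLIntegral_const, Real.volume_Ico, ← ENNReal.ofReal_mul (by positivity)]
    _ ≤ _ := ENNReal.ofReal_le_ofReal ?_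
  have h := mul_le_mul_of_nonneg_left (setIntegral_powerWeight_ge hγ hab)
    (show (0:ℝ) ≤ 4 * 2 ^ γ by positivity)
  refine le_trans (le_of_eq ?_) h
  rw [Real.div_rpow (by positivity) two_pos.le]
  field_simp

/-- For `β ∈ (0,1)`, `p ∈ (1,∞)` and the weights `w(x) = |x|^{-β}`,
`σ(x) = |x|^{β/(p-1)}` (with `w(0) = σ(0) = 1`), one has `[w,σ]_{A_p} ≍ (1-β)^{-1}`
with comparability constants depending only on `p`; moreover `[w]_{A_∞} ≤ C (1-β)^{-1}`
for an absolute constant `C`, and `[σ]_{A_∞} ≤ C(p)` for a constant depending only on `p`. -/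
theorem statement3 :
    ∃ C₀ > (0:ℝ), ∀ p : ℝ, 1 < p →
      ∃ c > (0:ℝ), ∃ C > (0:ℝ), ∃ Cp > (0:ℝ), ∀ β ∈ Set.Ioo (0:ℝ) 1,
        ENNReal.ofReal (c * (1 - β)⁻¹) ≤
            apChar p (fun x => if x = 0 then 1 else |x| ^ (-β))
              (fun x => if x = 0 then 1 else |x| ^ (β / (p - 1))) ∧
        apChar p (fun x => if x = 0 then 1 else |x| ^ (-β))
            (fun x => if x = 0 then 1 else |x| ^ (β / (p - 1))) ≤
          ENNReal.ofReal (C * (1 - β)⁻¹) ∧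
        ainfChar (fun x => if x = 0 then 1 else |x| ^ (-β)) ≤
          ENNReal.ofReal (C₀ * (1 - β)⁻¹) ∧
        ainfChar (fun x => if x = 0 then 1 else |x| ^ (β / (p - 1))) ≤
          ENNReal.ofReal Cp := by
  refine ⟨4, by norm_num, fun p hp => ?_⟩
  have hp' : 0 < p - 1 := by linarith
  have hp0 : 0 < p := by linarith
  refine ⟨(p / (p - 1))⁻¹ ^ (p - 1), by positivity, 4, by norm_num, 4 * 2 ^ (1 / (p - 1)),
    by positivity, fun β hβ => ⟨le_apChar_powerWeight hp hβ.1 hβ.2,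
      apChar_powerWeight_le hp hβ.1 hβ.2, ainfChar_powerWeight_neg_le hβ.1 hβ.2,
      (ainfChar_powerWeight_le (div_nonneg hβ.1.le hp'.le)).trans
        (ENNReal.ofReal_le_ofReal ?_)⟩⟩
  gcongr
  · norm_num
  · exact hβ.2.le

end
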